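/- Let α ∈ (−1, 0) and x ∈ (0, π), and let r := r_{α,x} ∈ (0, 1) be the unique root in t of Î_α(x, t) := C_{−α}(x(1 − t)) + C_{−α}(x(1 + t)) − 2C_{−α}(xt). Then the integral U_α(x) := ∫₀^π |C_{−α}(x − y) + C_{−α}(x + y) − 2C_{−α}(y)|·y dy equals 2·(C_{2−α}(x) − ζ(2−α)) + 2·(C_{2−α}(x + π) − C_{2−α}(π)) − 2·(C_{2−α}(x(1 − r)) + C_{2−α}(x(1 + r)) − 2C_{2−α}(xr)) − 2xr·(−S_{1−α}(x(1 − r)) + S_{1−α}(x(1 + r)) − 2S_{1−α}(xr)). -/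

import Mathlib

open scoped Real
open Set

/-- The Clausen function `C_s(x) = Re (Li_s (e^{ix}))`, realized via the periodic
(cosine) zeta function, which is automatically `2π`-periodic and even in `x`. -/
noncomputable def Cl (s x : ℝ) : ℝ :=
  (HurwitzZeta.cosZeta (↑(x / (2 * π)) : UnitAddCircle) (s : ℂ)).re

/-- The odd Clausen function `S_s(x) = Im (Li_s (e^{ix}))`, realized via the periodic
(sine) zeta function, which is automatically `2π`-periodic and odd in `x`. -/
noncomputable def Sl (s x : ℝ) : ℝ :=
  (HurwitzZeta.sinZeta (↑(x / (2 * π)) : UnitAddCircle) (s : ℂ)).re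

/-- The Riemann zeta function at real arguments. -/
noncomputable def realZeta (s : ℝ) : ℝ := (riemannZeta (s : ℂ)).re

/-- `Î_α(x, t) = C_{-α}(x(1-t)) + C_{-α}(x(1+t)) - 2 C_{-α}(xt)`. -/
noncomputable def Ihat (α x t : ℝ) : ℝ :=
  Cl (-α) (x * (1 - t)) + Cl (-α) (x * (1 + t)) - 2 * Cl (-α) (x * t)

open Filter Topology

/-- Mean value bound for the complex powers `p ^ (-s)` of positive reals. -/
lemma norm_cpow_neg_sub_cpow_neg_le {s : ℂ} (hs : 0 < s.re) {m p q : ℝ} (hm : 0 < m)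
    (hp : m ≤ p) (hq : m ≤ q) :
    ‖(p : ℂ) ^ (-s) - (q : ℂ) ^ (-s)‖ ≤ ‖s‖ * m ^ (-s.re - 1) * |p - q| := by
  have hs0 : -s ≠ 0 := by
    intro h
    simp [neg_eq_zero.mp h] at hs
  have := Convex.norm_image_sub_le_of_norm_hasDerivWithin_le (𝕜 := ℝ) (s := Ici m)
    (f := fun y : ℝ => (y : ℂ) ^ (-s)) (f' := fun y : ℝ => -s * (y : ℂ) ^ (-s - 1))
    (C := ‖s‖ * m ^ (-s.re - 1)) (x := q) (y := p) ?_ ?_ (convex_Ici m) hq hp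
  · simpa [Real.norm_eq_abs] using this
  · intro y hy
    exact (hasDerivAt_ofReal_cpow_const (hm.trans_le hy).ne' hs0).hasDerivWithinAt
  · intro y hy
    rw [norm_mul, norm_neg, Complex.norm_cpow_eq_rpow_re_of_pos (hm.trans_le hy)]
    simp only [Complex.sub_re, Complex.neg_re, Complex.one_re]
    exact mul_le_mul_of_nonneg_left
      (Real.rpow_le_rpow_of_nonpos hm hy (by linarith)) (norm_nonneg s)

lemma norm_weighted_cpow_sub_le {w : ℕ → ℂ} (hw : ∀ n, ‖w n‖ ≤ 1) {p q : ℕ → ℝ} {c : ℝ}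
    (hc : 0 < c) (hp : ∀ n : ℕ, c * (n + 1) ≤ p n) (hq : ∀ n : ℕ, c * (n + 1) ≤ q n)
    (hpq : ∀ n, |p n - q n| ≤ 1) {s : ℂ} (hs : 0 < s.re) (n : ℕ) :
    ‖w n * ((p n : ℂ) ^ (-s) - (q n : ℂ) ^ (-s))‖ ≤
      ‖s‖ * c ^ (-s.re - 1) * ((n : ℝ) + 1) ^ (-s.re - 1) := by
  have hn : (0 : ℝ) < n + 1 := by positivity
  have h := norm_cpow_neg_sub_cpow_neg_le hs (mul_pos hc hn) (hp n) (hq n)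
  rw [Real.mul_rpow hc.le hn.le] at h
  rw [norm_mul]
  calc ‖w n‖ * ‖(p n : ℂ) ^ (-s) - (q n : ℂ) ^ (-s)‖
      ≤ 1 * (‖s‖ * (c ^ (-s.re - 1) * ((n : ℝ) + 1) ^ (-s.re - 1)) * 1) := by
        refine mul_le_mul (hw n) (h.trans ?_) (norm_nonneg _) zero_le_one
        exact mul_le_mul_of_nonneg_left (hpq n) (by positivity)
    _ = _ := by ring

lemma summable_nat_add_one_rpow {t : ℝ} (ht : 0 < t) :
    Summable fun n : ℕ => ((n : ℝ) + 1) ^ (-t - 1) := by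
  have := (summable_nat_add_iff 1).mpr (Real.summable_nat_rpow.mpr (by linarith : -t - 1 < -1))
  simpa using this

/-- A weighted series of differences of powers at points at bounded distance defines a
holomorphic function on the right half plane. -/
lemma differentiableOn_tsum_weighted_cpow_sub {w : ℕ → ℂ} (hw : ∀ n, ‖w n‖ ≤ 1)
    {p q : ℕ → ℝ} {c : ℝ} (hc : 0 < c) (hc1 : c ≤ 1) (hp : ∀ n : ℕ, c * (n + 1) ≤ p n)
    (hq : ∀ n : ℕ, c * (n + 1) ≤ q n) (hpq : ∀ n, |p n - q n| ≤ 1) :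
    DifferentiableOn ℂ (fun s : ℂ => ∑' n, w n * ((p n : ℂ) ^ (-s) - (q n : ℂ) ^ (-s)))
      {s : ℂ | 0 < s.re} := by
  intro s₀ hs₀
  simp only [mem_ofPred_eq] at hs₀
  set δ := s₀.re / 2 with hδ
  have hδ0 : 0 < δ := by linarith
  set R := ‖s₀‖ + 1 with hR
  have hU : IsOpen ({s : ℂ | δ < s.re} ∩ Metric.ball 0 R) :=
    (isOpen_lt continuous_const Complex.continuous_re).inter Metric.isOpen_ball
  have hpos : ∀ n, 0 < p n ∧ 0 < q n := fun n =>
    ⟨lt_of_lt_of_le (by positivity) (hp n), lt_of_lt_of_le (by positivity) (hq n)⟩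
  have key : DifferentiableOn ℂ (fun s : ℂ => ∑' n, w n * ((p n : ℂ) ^ (-s) - (q n : ℂ) ^ (-s)))
      ({s : ℂ | δ < s.re} ∩ Metric.ball 0 R) := by
    refine Complex.differentiableOn_tsum_of_summable_norm
      (u := fun n : ℕ => R * c ^ (-R - 1) * ((n : ℝ) + 1) ^ (-δ - 1))
      ((summable_nat_add_one_rpow hδ0).mul_left _) (fun n => ?_) hU (fun n s hs => ?_)
    · have h1 : (p n : ℂ) ≠ 0 := by exact_mod_cast (hpos n).1.ne'
      have h2 : (q n : ℂ) ≠ 0 := by exact_mod_cast (hpos n).2.ne'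
      intro s _
      exact (((differentiableAt_id.neg.const_cpow (Or.inl h1)).sub
        (differentiableAt_id.neg.const_cpow (Or.inl h2))).const_mul _).differentiableWithinAt
    · obtain ⟨hs1, hs2⟩ := hs
      simp only [mem_ofPred_eq] at hs1
      have hs3 : ‖s‖ < R := by simpa using hs2
      have hre : s.re ≤ R := (Complex.re_le_norm s).trans hs3.le
      refine (norm_weighted_cpow_sub_le hw hc hp hq hpq (hδ0.trans hs1) n).trans ?_
      have h1 : c ^ (-s.re - 1) ≤ c ^ (-R - 1) :=
        Real.rpow_le_rpow_of_exponent_ge hc hc1 (by linarith)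
      have h2 : ((n : ℝ) + 1) ^ (-s.re - 1) ≤ ((n : ℝ) + 1) ^ (-δ - 1) :=
        Real.rpow_le_rpow_of_exponent_le (by simp) (by linarith)
      gcongr
  refine (key.differentiableAt (hU.mem_nhds ⟨?_, ?_⟩)).differentiableWithinAt
  · simp only [mem_ofPred_eq]; linarith
  · simp [hR]

lemma summable_weighted_cpow_sub {w : ℕ → ℂ} (hw : ∀ n, ‖w n‖ ≤ 1)
    {p q : ℕ → ℝ} {c : ℝ} (hc : 0 < c) (hp : ∀ n : ℕ, c * (n + 1) ≤ p n)
    (hq : ∀ n : ℕ, c * (n + 1) ≤ q n) (hpq : ∀ n, |p n - q n| ≤ 1) {s : ℂ} (hs : 0 < s.re) :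
    Summable fun n => w n * ((p n : ℂ) ^ (-s) - (q n : ℂ) ^ (-s)) :=
  .of_norm_bounded ((summable_nat_add_one_rpow hs).mul_left _)
    (norm_weighted_cpow_sub_le hw hc hp hq hpq hs)

/-- Holomorphic functions on the right half plane agreeing on `1 < re s` are equal. -/
lemma eqOn_re_pos_of_eqOn_one_lt_re {f g : ℂ → ℂ} (hf : DifferentiableOn ℂ f {s : ℂ | 0 < s.re})
    (hg : DifferentiableOn ℂ g {s : ℂ | 0 < s.re}) (h : ∀ s : ℂ, 1 < s.re → f s = g s) :
    EqOn f g {s : ℂ | 0 < s.re} := by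
  have ho : IsOpen {s : ℂ | 0 < s.re} := isOpen_lt continuous_const Complex.continuous_re
  refine (hf.analyticOnNhd ho).eqOn_of_preconnected_of_eventuallyEq (hg.analyticOnNhd ho)
    (convex_halfSpace_re_gt 0).isPreconnected (z₀ := 2) (by simp) ?_
  filter_upwards [(isOpen_lt continuous_const Complex.continuous_re).mem_nhds
    (show (1 : ℝ) < (2 : ℂ).re by simp)] with s hs using h s hs

/-- The difference of two even Hurwitz zeta functions as a series converging on `0 < re s`. -/
lemma hasSum_hurwitzZetaEven_sub {a : ℝ} (ha : a ∈ Ioo (0 : ℝ) 1) {s : ℂ} (hs : 0 < s.re) :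
    HasSum (fun n : ℕ => ((((n + a : ℝ) : ℂ) ^ (-s) - ((n + 1 / 2 : ℝ) : ℂ) ^ (-s)) +
        (((n + (1 - a) : ℝ) : ℂ) ^ (-s) - ((n + 1 / 2 : ℝ) : ℂ) ^ (-s))) / 2)
      (HurwitzZeta.hurwitzZetaEven (a : UnitAddCircle) s -
        HurwitzZeta.hurwitzZetaEven ((1 / 2 : ℝ) : UnitAddCircle) s) := by
  have bound : ∀ b ∈ Ioo (0 : ℝ) 1, ∃ c : ℝ, 0 < c ∧ c ≤ 1 ∧
      (∀ n : ℕ, c * (n + 1) ≤ (n : ℝ) + b) ∧ (∀ n : ℕ, c * (n + 1) ≤ (n : ℝ) + 1 / 2) ∧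
      ∀ n : ℕ, |((n : ℝ) + b) - (n + 1 / 2)| ≤ 1 := by
    intro b hb
    have h1 : min b (1 / 2) ≤ b := min_le_left _ _
    have h2 : min b (1 / 2) ≤ 1 / 2 := min_le_right _ _
    have h3 (n : ℕ) : (0 : ℝ) ≤ n := n.cast_nonneg
    refine ⟨min b (1 / 2), lt_min hb.1 (by norm_num), by linarith, fun n => ?_, fun n => ?_,
      fun n => ?_⟩
    · nlinarith [h3 n]
    · nlinarith [h3 n]
    · rw [abs_le]; constructor <;> linarith [hb.1, hb.2]
  have hw : ∀ n : ℕ, ‖(fun _ : ℕ => (1 : ℂ)) n‖ ≤ 1 := by simp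
  have ha' : 1 - a ∈ Ioo (0 : ℝ) 1 := ⟨by linarith [ha.2], by linarith [ha.1]⟩
  obtain ⟨c, hc, hc1, hp, hq, hpq⟩ := bound a ha
  obtain ⟨c', hc', hc1', hp', hq', hpq'⟩ := bound (1 - a) ha'
  have hsum : ∀ {s : ℂ}, 0 < s.re → HasSum (fun n : ℕ =>
      ((((n + a : ℝ) : ℂ) ^ (-s) - ((n + 1 / 2 : ℝ) : ℂ) ^ (-s)) +
        (((n + (1 - a) : ℝ) : ℂ) ^ (-s) - ((n + 1 / 2 : ℝ) : ℂ) ^ (-s))) / 2)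
      (((∑' n : ℕ, 1 * (((n + a : ℝ) : ℂ) ^ (-s) - ((n + 1 / 2 : ℝ) : ℂ) ^ (-s))) +
        ∑' n : ℕ, 1 * (((n + (1 - a) : ℝ) : ℂ) ^ (-s) - ((n + 1 / 2 : ℝ) : ℂ) ^ (-s))) / 2) := by
    intro s hs
    have h1 := (summable_weighted_cpow_sub hw hc hp hq hpq hs).hasSum
    have h2 := (summable_weighted_cpow_sub hw hc' hp' hq' hpq' hs).hasSum
    simpa using (h1.add h2).div_const 2
  have key := eqOn_re_pos_of_eqOn_one_lt_re
    (HurwitzZeta.differentiable_hurwitzZetaEven_sub_hurwitzZetaEven (a : UnitAddCircle)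
      ((1 / 2 : ℝ) : UnitAddCircle)).differentiableOn
    (((differentiableOn_tsum_weighted_cpow_sub hw hc hc1 hp hq hpq).add
      (differentiableOn_tsum_weighted_cpow_sub hw hc' hc1' hp' hq' hpq')).div_const 2) ?_ hs
  · simp only [Pi.add_apply] at key
    rw [key]
    exact hsum hs
  · intro s hs
    refine HasSum.unique ?_ (hsum (zero_lt_one.trans hs))
    have h1 := HurwitzZeta.hasSum_nat_hurwitzZetaEven_of_mem_Icc ⟨ha.1.le, ha.2.le⟩ hs
    have h2 := HurwitzZeta.hasSum_nat_hurwitzZetaEven_of_mem_Icc (a := 1 / 2)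
      ⟨by norm_num, by norm_num⟩ hs
    refine (h1.sub h2).congr_fun fun n => ?_
    have e : (n : ℂ) + 1 - ((1 / 2 : ℝ) : ℂ) = n + 1 / 2 := by push_cast; ring
    rw [e]
    simp only [Complex.cpow_neg, one_div]
    push_cast
    ring_nf

/-- For `0 < s < 1` the Clausen function is, up to constants, a positive combination of
powers of the distances to the points of `2πℤ`. -/
lemma exists_hasSum_Cl_sub {s : ℝ} (hs : s ∈ Ioo (0 : ℝ) 1) :
    ∃ K : ℝ, 0 < K ∧ ∀ a ∈ Ioo (0 : ℝ) 1, HasSum (fun n : ℕ =>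
      K * (((n : ℝ) + a) ^ (s - 1) + ((n : ℝ) + (1 - a)) ^ (s - 1)
        - 2 * ((n : ℝ) + 1 / 2) ^ (s - 1)))
      (Cl s (2 * π * a) - Cl s π) := by
  obtain ⟨hs0, hs1⟩ := hs
  refine ⟨(2 * π) ^ (-(1 - s)) * Real.Gamma (1 - s) * Real.cos (π * (1 - s) / 2), ?_, ?_⟩
  · have h1 := Real.Gamma_pos_of_pos (by linarith : 0 < 1 - s)
    have h2 : 0 < Real.cos (π * (1 - s) / 2) := by
      apply Real.cos_pos_of_mem_Ioo
      constructor <;> nlinarith [Real.pi_pos]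
    positivity
  intro a ha
  have hne : ∀ n : ℕ, (1 - s : ℂ) ≠ 1 - n := by
    intro n h
    have h' : s = n := by
      have : (s : ℂ) = n := by linear_combination -h
      exact_mod_cast this
    rw [h'] at hs0 hs1
    have h3 : 0 < n := by exact_mod_cast hs0
    have h4 : n < 1 := by exact_mod_cast hs1
    omega
  have hre : 0 < (1 - s : ℂ).re := by simpa using hs1
  have h := (hasSum_hurwitzZetaEven_sub ha hre).mul_left
    (2 * (2 * π : ℂ) ^ (-(1 - s : ℂ)) * Complex.Gamma (1 - s) * Complex.cos (π * (1 - s) / 2))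
  rw [mul_sub _ (HurwitzZeta.hurwitzZetaEven _ _), ← HurwitzZeta.cosZeta_one_sub _ hne,
    ← HurwitzZeta.cosZeta_one_sub _ hne, sub_sub_cancel] at h
  have h' := Complex.hasSum_re h
  have e1 : (2 * π * a) / (2 * π) = a := by field_simp
  have e2 : π / (2 * π) = 1 / 2 := by field_simp
  rw [Complex.sub_re] at h'
  rw [Cl, Cl, e1, e2]
  refine h'.congr_fun fun n => ?_
  have hn : (0 : ℝ) ≤ n := n.cast_nonneg
  have c1 : (-(1 - s : ℂ)) = ((s - 1 : ℝ) : ℂ) := by push_cast; ring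
  have c2 : (2 * π : ℂ) = ((2 * π : ℝ) : ℂ) := by push_cast; ring
  have c3 : Complex.Gamma (1 - s) = ((Real.Gamma (1 - s) : ℝ) : ℂ) := by
    rw [← Complex.Gamma_ofReal]; push_cast; rfl
  have c4 : Complex.cos (π * (1 - s) / 2) = ((Real.cos (π * (1 - s) / 2) : ℝ) : ℂ) := by
    push_cast; rfl
  rw [c1, c2, c3, c4, ← Complex.ofReal_cpow (by positivity),
    ← Complex.ofReal_cpow (by linarith [ha.1]), ← Complex.ofReal_cpow (by positivity),
    ← Complex.ofReal_cpow (by linarith [ha.2])]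
  norm_cast
  rw [neg_sub]
  ring

lemma two_mul_rpow_neg_le {p q σ : ℝ} (hp : 0 < p) (hq : 0 < q) (hσ : σ ≤ 0) :
    2 * ((p + q) / 2) ^ σ ≤ p ^ σ + q ^ σ := by
  have h : (((p + q) / 2) ^ σ) ^ 2 ≤ p ^ σ * q ^ σ := by
    rw [← Real.mul_rpow hp.le hq.le, sq, ← Real.mul_rpow (by positivity) (by positivity)]
    exact Real.rpow_le_rpow_of_nonpos (by positivity) (by nlinarith [sq_nonneg (p - q)]) hσ
  have h1 : 0 < p ^ σ := by positivity
  have h2 : 0 < q ^ σ := by positivity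
  nlinarith [sq_nonneg (p ^ σ - q ^ σ)]

/-- Midpoint convexity of `C_s` on `(0, 2π)` for `0 < s < 1`. -/
lemma two_mul_Cl_le {s : ℝ} (hs : s ∈ Ioo (0 : ℝ) 1) {u v : ℝ} (hu : u ∈ Ioo 0 (2 * π))
    (hv : v ∈ Ioo 0 (2 * π)) : 2 * Cl s ((u + v) / 2) ≤ Cl s u + Cl s v := by
  obtain ⟨K, hK, h⟩ := exists_hasSum_Cl_sub hs
  have hπ : 0 < 2 * π := Real.two_pi_pos
  have mem : ∀ {y : ℝ}, y ∈ Ioo 0 (2 * π) → y / (2 * π) ∈ Ioo (0 : ℝ) 1 := fun hy =>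
    ⟨div_pos hy.1 hπ, (div_lt_one hπ).mpr hy.2⟩
  have hu' := mem hu
  have hv' := mem hv
  have hm' : (u / (2 * π) + v / (2 * π)) / 2 ∈ Ioo (0 : ℝ) 1 :=
    ⟨by linarith [hu'.1, hv'.1], by linarith [hu'.2, hv'.2]⟩
  have eu : 2 * π * (u / (2 * π)) = u := by field_simp
  have ev : 2 * π * (v / (2 * π)) = v := by field_simp
  have em : 2 * π * ((u / (2 * π) + v / (2 * π)) / 2) = (u + v) / 2 := by field_simp
  have h1 := h _ hu'
  have h2 := h _ hv'
  have h3 := h _ hm'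
  rw [eu] at h1
  rw [ev] at h2
  rw [em] at h3
  generalize u / (2 * π) = a at *
  generalize v / (2 * π) = b at *
  have := hasSum_le (fun n => ?_) (h3.mul_left 2) (h1.add h2)
  · linarith
  · have hn : (0 : ℝ) ≤ n := n.cast_nonneg
    have hσ : s - 1 ≤ 0 := by linarith [hs.2]
    have i1 := two_mul_rpow_neg_le (by linarith [hu'.1] : 0 < (n : ℝ) + a)
      (by linarith [hv'.1] : 0 < (n : ℝ) + b) hσ
    have i2 := two_mul_rpow_neg_le (by linarith [hu'.2] : 0 < (n : ℝ) + (1 - a))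
      (by linarith [hv'.2] : 0 < (n : ℝ) + (1 - b)) hσ
    rw [show ((n : ℝ) + a + (n + b)) / 2 = n + (a + b) / 2 by ring] at i1
    rw [show ((n : ℝ) + (1 - a) + (n + (1 - b))) / 2 = n + (1 - (a + b) / 2) by ring] at i2
    nlinarith

/-- `C_s` blows up at `0⁺` for `0 < s < 1`. -/
lemma tendsto_Cl_nhdsGT_zero {s : ℝ} (hs : s ∈ Ioo (0 : ℝ) 1) :
    Tendsto (Cl s) (𝓝[>] 0) atTop := by
  obtain ⟨K, hK, h⟩ := exists_hasSum_Cl_sub hs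
  have hπ : 0 < 2 * π := Real.two_pi_pos
  have hσ : s - 1 < 0 := by linarith [hs.2]
  have lower : ∀ᶠ u in 𝓝[>] (0 : ℝ),
      K * (u / (2 * π)) ^ (s - 1) + (Cl s π - K * (2 * (1 / 2) ^ (s - 1))) ≤ Cl s u := by
    filter_upwards [Ioo_mem_nhdsGT hπ] with u hu
    have ha : u / (2 * π) ∈ Ioo (0 : ℝ) 1 := ⟨div_pos hu.1 hπ, (div_lt_one hπ).mpr hu.2⟩
    have eu : 2 * π * (u / (2 * π)) = u := by field_simp
    have h1 := h _ ha
    rw [eu] at h1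
    generalize u / (2 * π) = a at *
    have h2 := le_hasSum h1 0 fun n _ => ?_
    · have h3 : 0 < (1 - a) ^ (s - 1) := Real.rpow_pos_of_pos (by linarith [ha.2]) _
      simp only [Nat.cast_zero, zero_add] at h2
      nlinarith
    · have hn : (0 : ℝ) ≤ n := n.cast_nonneg
      have i1 := two_mul_rpow_neg_le (by linarith [ha.1] : 0 < (n : ℝ) + a)
        (by linarith [ha.2] : 0 < (n : ℝ) + (1 - a)) hσ.le
      rw [show ((n : ℝ) + a + (n + (1 - a))) / 2 = n + 1 / 2 by ring] at i1
      exact mul_nonneg hK.le (by linarith)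
  refine tendsto_atTop_mono' _ lower (tendsto_atTop_add_const_right _ _ ?_)
  refine Tendsto.const_mul_atTop hK ?_
  refine (tendsto_rpow_neg_nhdsGT_zero hσ).comp ?_
  refine tendsto_nhdsWithin_iff.mpr ⟨?_, ?_⟩
  · have : Tendsto (fun u : ℝ => u / (2 * π)) (𝓝 0) (𝓝 (0 / (2 * π))) :=
      (continuous_id.div_const _).tendsto 0
    rw [zero_div] at this
    exact this.mono_left nhdsWithin_le_nhds
  · filter_upwards [self_mem_nhdsWithin] with u hu using div_pos hu hπ

lemma hasSum_expZeta_div_two_pi (u : ℝ) {s : ℂ} (hs : 1 < s.re) :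
    HasSum (fun n : ℕ => Complex.exp (u * Complex.I) ^ (n + 1) * ((n + 1 : ℝ) : ℂ) ^ (-s))
      (HurwitzZeta.expZeta ((u / (2 * π) : ℝ) : UnitAddCircle) s) := by
  have h := HurwitzZeta.hasSum_expZeta_of_one_lt_re (u / (2 * π)) hs
  rw [← hasSum_nat_add_iff' 1] at h
  have hs0 : s ≠ 0 := by
    rintro rfl
    simp at hs
    linarith
  simp only [Finset.range_one, Finset.sum_singleton, Nat.cast_zero, Complex.zero_cpow hs0,
    div_zero, sub_zero] at h
  refine h.congr_fun fun n => ?_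
  have hπ : (π : ℂ) ≠ 0 := by exact_mod_cast Real.pi_ne_zero
  rw [Complex.cpow_neg, div_eq_mul_inv, ← Complex.exp_nat_mul]
  push_cast
  congr 2
  field_simp

lemma norm_exp_pow (u : ℝ) (n : ℕ) : ‖Complex.exp (u * Complex.I) ^ n‖ = 1 := by
  rw [norm_pow, Complex.norm_exp_ofReal_mul_I, one_pow]

/-- Summation by parts for a power series. -/
lemma one_sub_mul_sum_pow (z : ℂ) (b : ℕ → ℂ) (N : ℕ) :
    (1 - z) * ∑ n ∈ Finset.range (N + 1), z ^ (n + 1) * b n =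
      z * b 0 + ∑ n ∈ Finset.range N, z ^ (n + 2) * (b (n + 1) - b n) - z ^ (N + 2) * b N := by
  induction N with
  | zero => simp; ring
  | succ N ih =>
    rw [Finset.sum_range_succ, mul_add, ih, Finset.sum_range_succ _ N]
    ring

/-- The Abel-summed series for `(1 - e^{iu}) Li_s(e^{iu})`. -/
noncomputable def abelExp (u : ℝ) (s : ℂ) : ℂ :=
  Complex.exp (u * Complex.I) + ∑' n : ℕ, Complex.exp (u * Complex.I) ^ (n + 2) *
    (((n + 2 : ℝ) : ℂ) ^ (-s) - ((n + 1 : ℝ) : ℂ) ^ (-s))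

lemma nat_add_two_bounds : (∀ n : ℕ, (1 : ℝ) * (n + 1) ≤ n + 2) ∧
    (∀ n : ℕ, (1 : ℝ) * (n + 1) ≤ n + 1) ∧ ∀ n : ℕ, |((n : ℝ) + 2) - (n + 1)| ≤ 1 := by
  refine ⟨fun n => by linarith, fun n => by linarith, fun n => ?_⟩
  rw [show ((n : ℝ) + 2) - (n + 1) = 1 by ring, abs_one]

lemma tendstoUniformly_abelExp {s : ℂ} (hs : 0 < s.re) :
    TendstoUniformly (fun (N : ℕ) (u : ℝ) => (1 - Complex.exp (u * Complex.I)) *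
      ∑ n ∈ Finset.range (N + 1),
        Complex.exp (u * Complex.I) ^ (n + 1) * ((n + 1 : ℝ) : ℂ) ^ (-s))
      (fun u => abelExp u s) atTop := by
  obtain ⟨hp, hq, hpq⟩ := nat_add_two_bounds
  have h1 := tendstoUniformly_tsum_nat
    (f := fun (n : ℕ) (u : ℝ) => Complex.exp (u * Complex.I) ^ (n + 2) *
      (((n + 2 : ℝ) : ℂ) ^ (-s) - ((n + 1 : ℝ) : ℂ) ^ (-s)))
    ((summable_nat_add_one_rpow hs).mul_left _)
    (fun n u => norm_weighted_cpow_sub_le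
      (w := fun n => Complex.exp (u * Complex.I) ^ (n + 2)) (fun n => (norm_exp_pow u _).le)
      one_pos hp hq hpq hs n)
  have h2 : Tendsto (fun N : ℕ => ‖((N + 1 : ℝ) : ℂ) ^ (-s)‖) atTop (𝓝 0) := by
    have : Tendsto (fun N : ℕ => ((N : ℝ) + 1) ^ (-s.re)) atTop (𝓝 0) :=
      (tendsto_rpow_neg_atTop hs).comp
        (tendsto_atTop_add_const_right _ _ tendsto_natCast_atTop_atTop)
    refine this.congr fun N => ?_
    rw [Complex.norm_cpow_eq_rpow_re_of_pos (by positivity), Complex.neg_re]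
  rw [Metric.tendstoUniformly_iff] at h1 ⊢
  intro ε hε
  filter_upwards [h1 (ε / 2) (half_pos hε), h2.eventually (gt_mem_nhds (half_pos hε))]
    with N hN1 hN2 u
  have hN := hN1 u
  have e := one_sub_mul_sum_pow (Complex.exp (u * Complex.I))
    (fun n : ℕ => ((n + 1 : ℝ) : ℂ) ^ (-s)) N
  have c1 : ∀ n : ℕ, (((n + 1 : ℕ) : ℝ) + 1) = (n : ℝ) + 2 := fun n => by push_cast; ring
  simp only [c1, Nat.cast_zero, zero_add, Complex.ofReal_one, Complex.one_cpow, mul_one] at e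
  rw [e, abelExp]
  rw [dist_eq_norm] at hN ⊢
  have tri := norm_add_le
    ((∑' n : ℕ, Complex.exp (u * Complex.I) ^ (n + 2) *
      (((n + 2 : ℝ) : ℂ) ^ (-s) - ((n + 1 : ℝ) : ℂ) ^ (-s))) -
      ∑ n ∈ Finset.range N, Complex.exp (u * Complex.I) ^ (n + 2) *
      (((n + 2 : ℝ) : ℂ) ^ (-s) - ((n + 1 : ℝ) : ℂ) ^ (-s)))
    (Complex.exp (u * Complex.I) ^ (N + 2) * ((N + 1 : ℝ) : ℂ) ^ (-s))
  rw [norm_mul _ (((N + 1 : ℝ) : ℂ) ^ (-s)), norm_exp_pow, one_mul] at tri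
  refine lt_of_le_of_lt ?_ (tri.trans_lt (by linarith : _ < ε))
  apply le_of_eq
  congr 1
  ring

lemma coe_div_two_pi_ne_zero {u : ℝ} (hu : Complex.exp (u * Complex.I) ≠ 1) :
    ((u / (2 * π) : ℝ) : UnitAddCircle) ≠ 0 := by
  intro h
  obtain ⟨n, hn⟩ := (AddCircle.coe_eq_zero_iff 1).mp h
  apply hu
  rw [Complex.exp_eq_one_iff]
  refine ⟨n, ?_⟩
  have : u = n * (2 * π) := by
    have hπ := Real.two_pi_pos.ne'
    rw [eq_div_iff hπ] at hn
    rw [← hn]; simp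
  rw [this]; push_cast; ring

lemma one_sub_exp_mul_expZeta {u : ℝ} (hu : Complex.exp (u * Complex.I) ≠ 1) {s : ℂ}
    (hs : 0 < s.re) :
    (1 - Complex.exp (u * Complex.I)) *
      HurwitzZeta.expZeta ((u / (2 * π) : ℝ) : UnitAddCircle) s = abelExp u s := by
  obtain ⟨hp, hq, hpq⟩ := nat_add_two_bounds
  refine eqOn_re_pos_of_eqOn_one_lt_re
    ((HurwitzZeta.differentiable_expZeta_of_ne_zero
      (coe_div_two_pi_ne_zero hu)).const_mul _).differentiableOn
    ((differentiableOn_tsum_weighted_cpow_sub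
      (w := fun n => Complex.exp (u * Complex.I) ^ (n + 2)) (fun n => (norm_exp_pow u _).le)
      one_pos le_rfl hp hq hpq).const_add _) (fun s hs => ?_) hs
  refine tendsto_nhds_unique ?_ ((tendstoUniformly_abelExp (zero_lt_one.trans hs)).tendsto_at u)
  exact ((hasSum_expZeta_div_two_pi u hs).tendsto_sum_nat.comp
    (tendsto_add_atTop_nat 1)).const_mul _

/-- Off `2πℤ`, the Dirichlet series of `Li_s(e^{iu})` converges locally uniformly in `u`. -/
lemma tendstoUniformlyOn_expZeta {s : ℂ} (hs : 0 < s.re) {δ : ℝ} (hδ : 0 < δ) :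
    TendstoUniformlyOn (fun (N : ℕ) (u : ℝ) => ∑ n ∈ Finset.range (N + 1),
        Complex.exp (u * Complex.I) ^ (n + 1) * ((n + 1 : ℝ) : ℂ) ^ (-s))
      (fun u => HurwitzZeta.expZeta ((u / (2 * π) : ℝ) : UnitAddCircle) s) atTop
      {u : ℝ | δ < ‖1 - Complex.exp (u * Complex.I)‖} := by
  have h := tendstoUniformly_abelExp hs
  rw [Metric.tendstoUniformly_iff] at h
  rw [Metric.tendstoUniformlyOn_iff]
  intro ε hε
  filter_upwards [h (δ * ε) (by positivity)] with N hN u hu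
  replace hu : δ < ‖1 - Complex.exp (u * Complex.I)‖ := hu
  have hne : Complex.exp (u * Complex.I) ≠ 1 := by
    intro h1
    rw [h1, sub_self, norm_zero] at hu
    linarith
  have hNu := hN u
  rw [← one_sub_exp_mul_expZeta hne hs, dist_eq_norm, ← mul_sub, norm_mul] at hNu
  rw [dist_eq_norm]
  by_contra! hcon
  have := mul_le_mul hu.le hcon hε.le (norm_nonneg _)
  linarith

lemma isOpen_lt_norm_one_sub_exp (δ : ℝ) :
    IsOpen {u : ℝ | δ < ‖1 - Complex.exp (u * Complex.I)‖} :=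
  isOpen_lt continuous_const (by fun_prop)

lemma half_norm_one_sub_exp {u : ℝ} (hu : Complex.exp (u * Complex.I) ≠ 1) :
    0 < ‖1 - Complex.exp (u * Complex.I)‖ / 2 ∧
      u ∈ {v : ℝ | ‖1 - Complex.exp (u * Complex.I)‖ / 2 < ‖1 - Complex.exp (v * Complex.I)‖} := by
  have h : 0 < ‖1 - Complex.exp (u * Complex.I)‖ := norm_pos_iff.mpr (sub_ne_zero.mpr hu.symm)
  exact ⟨half_pos h, half_lt_self h⟩

lemma continuousAt_expZeta {s : ℂ} (hs : 0 < s.re) {u : ℝ}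
    (hu : Complex.exp (u * Complex.I) ≠ 1) :
    ContinuousAt (fun u : ℝ => HurwitzZeta.expZeta ((u / (2 * π) : ℝ) : UnitAddCircle) s) u := by
  obtain ⟨hδ, hmem⟩ := half_norm_one_sub_exp hu
  refine ((tendstoUniformlyOn_expZeta hs hδ).continuousOn
    (Frequently.of_forall fun N => ?_)).continuousAt ((isOpen_lt_norm_one_sub_exp _).mem_nhds hmem)
  exact Continuous.continuousOn (by fun_prop)

lemma continuous_expZeta {s : ℂ} (hs : 1 < s.re) :
    Continuous fun u : ℝ => HurwitzZeta.expZeta ((u / (2 * π) : ℝ) : UnitAddCircle) s := by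
  have e : (fun u : ℝ => HurwitzZeta.expZeta ((u / (2 * π) : ℝ) : UnitAddCircle) s) =
      fun u : ℝ => ∑' n : ℕ,
        Complex.exp (u * Complex.I) ^ (n + 1) * ((n + 1 : ℝ) : ℂ) ^ (-s) :=
    funext fun u => (hasSum_expZeta_div_two_pi u hs).tsum_eq.symm
  rw [e]
  refine continuous_tsum (u := fun n : ℕ => ((n : ℝ) + 1) ^ (-(s.re - 1) - 1))
    (fun n => by fun_prop) (summable_nat_add_one_rpow (by linarith)) fun n u => ?_
  rw [norm_mul, norm_exp_pow, one_mul, Complex.norm_cpow_eq_rpow_re_of_pos (by positivity),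
    Complex.neg_re]
  apply le_of_eq
  congr 1
  ring

/-- Raising the order of the polylogarithm by one amounts to integrating in `u`. -/
lemma hasDerivAt_expZeta {s : ℂ} (hs : 0 < s.re) {u : ℝ}
    (hu : Complex.exp (u * Complex.I) ≠ 1) :
    HasDerivAt (fun u : ℝ => HurwitzZeta.expZeta ((u / (2 * π) : ℝ) : UnitAddCircle) (s + 1))
      (Complex.I * HurwitzZeta.expZeta ((u / (2 * π) : ℝ) : UnitAddCircle) s) u := by
  obtain ⟨hδ, hmem⟩ := half_norm_one_sub_exp hu
  have hs1 : 1 < (s + 1).re := by simpa using hs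
  refine hasDerivAt_of_tendstoLocallyUniformlyOn (l := atTop)
    (f := fun (N : ℕ) (u : ℝ) => ∑ n ∈ Finset.range (N + 1),
        Complex.exp (u * Complex.I) ^ (n + 1) * ((n + 1 : ℝ) : ℂ) ^ (-(s + 1)))
    (f' := fun (N : ℕ) (u : ℝ) => Complex.I * ∑ n ∈ Finset.range (N + 1),
        Complex.exp (u * Complex.I) ^ (n + 1) * ((n + 1 : ℝ) : ℂ) ^ (-s))
    (g' := fun u : ℝ => Complex.I *
      HurwitzZeta.expZeta ((u / (2 * π) : ℝ) : UnitAddCircle) s)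
    (isOpen_lt_norm_one_sub_exp _) ?_ (Eventually.of_forall fun N v _ => ?_)
    (fun v _ => (hasSum_expZeta_div_two_pi v hs1).tendsto_sum_nat.comp
      (tendsto_add_atTop_nat 1)) hmem
  · have h := tendstoUniformlyOn_expZeta hs hδ
    refine TendstoUniformlyOn.tendstoLocallyUniformlyOn ?_
    rw [Metric.tendstoUniformlyOn_iff] at h ⊢
    intro ε hε
    filter_upwards [h ε hε] with N hN v hv
    have := hN v hv
    rwa [dist_eq_norm, ← mul_sub, norm_mul, Complex.norm_I, one_mul, ← dist_eq_norm]
  · rw [Finset.mul_sum]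
    refine HasDerivAt.fun_sum fun n _ => ?_
    have h1 : HasDerivAt (fun v : ℝ => Complex.exp (v * Complex.I))
        (Complex.exp (v * Complex.I) * Complex.I) v := by
      have := ((Complex.ofRealCLM.hasDerivAt (x := v)).mul_const Complex.I).cexp
      simpa using this
    convert! (h1.pow (n + 1)).mul_const (((n + 1 : ℝ) : ℂ) ^ (-(s + 1))) using 1
    have hn : ((n + 1 : ℝ) : ℂ) ≠ 0 := by exact_mod_cast (by positivity : (n + 1 : ℝ) ≠ 0)
    have e : ((n + 1 : ℝ) : ℂ) ^ (-s) = ((n + 1 : ℝ) : ℂ) * ((n + 1 : ℝ) : ℂ) ^ (-(s + 1)) := by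
      rw [show -s = 1 + -(s + 1) by ring, Complex.cpow_add _ _ hn, Complex.cpow_one]
    rw [e]
    push_cast
    ring

lemma Cl_eq_re (s u : ℝ) : Cl s u =
    ((HurwitzZeta.expZeta ((u / (2 * π) : ℝ) : UnitAddCircle) s +
      HurwitzZeta.expZeta (((-u) / (2 * π) : ℝ) : UnitAddCircle) s) / 2).re := by
  rw [Cl, HurwitzZeta.cosZeta_eq, neg_div, AddCircle.coe_neg]

lemma Sl_eq_re (s u : ℝ) : Sl s u =
    ((HurwitzZeta.expZeta ((u / (2 * π) : ℝ) : UnitAddCircle) s -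
      HurwitzZeta.expZeta (((-u) / (2 * π) : ℝ) : UnitAddCircle) s) / (2 * Complex.I)).re := by
  rw [Sl, HurwitzZeta.sinZeta_eq, neg_div, AddCircle.coe_neg]

lemma exp_neg_mul_I_ne_one {u : ℝ} (hu : Complex.exp (u * Complex.I) ≠ 1) :
    Complex.exp ((-u : ℝ) * Complex.I) ≠ 1 := by
  rw [Complex.ofReal_neg, neg_mul, Complex.exp_neg]
  simpa using hu

lemma exp_mul_I_ne_one_of_abs_lt {u : ℝ} (h0 : u ≠ 0) (h : |u| < 2 * π) :
    Complex.exp (u * Complex.I) ≠ 1 := by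
  intro he
  have hcos : Real.cos u = 1 := by
    have := congrArg Complex.re he
    rwa [Complex.exp_ofReal_mul_I_re, Complex.one_re] at this
  exact h0 ((Real.cos_eq_one_iff_of_lt_of_lt (abs_lt.mp h).1 (abs_lt.mp h).2).mp hcos)

lemma continuous_Cl {s : ℝ} (hs : 1 < s) : Continuous (Cl s) := by
  have h := continuous_expZeta (s := s) (by simpa using hs)
  have e := funext (Cl_eq_re s)
  rw [e]
  exact Complex.continuous_re.comp ((h.add (h.comp continuous_neg)).div_const 2)

lemma continuous_Sl {s : ℝ} (hs : 1 < s) : Continuous (Sl s) := by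
  have h := continuous_expZeta (s := s) (by simpa using hs)
  have e := funext (Sl_eq_re s)
  rw [e]
  exact Complex.continuous_re.comp ((h.sub (h.comp continuous_neg)).div_const _)

lemma continuousAt_Cl {s : ℝ} (hs : 0 < s) {u : ℝ} (hu : Complex.exp (u * Complex.I) ≠ 1) :
    ContinuousAt (Cl s) u := by
  have h1 := continuousAt_expZeta (s := s) (by simpa using hs) hu
  have h2 := continuousAt_expZeta (s := s) (by simpa using hs) (exp_neg_mul_I_ne_one hu)
  have e := funext (Cl_eq_re s)
  rw [e]
  exact Complex.continuous_re.continuousAt.comp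
    ((h1.add (h2.comp (f := fun u : ℝ => -u) continuous_neg.continuousAt)).div_const 2)

lemma hasDerivAt_Sl {s : ℝ} (hs : 0 < s) {u : ℝ} (hu : Complex.exp (u * Complex.I) ≠ 1) :
    HasDerivAt (Sl (s + 1)) (Cl s u) u := by
  have h1 := hasDerivAt_expZeta (s := s) (by simpa using hs) hu
  have h2 := (hasDerivAt_expZeta (s := s) (by simpa using hs)
    (exp_neg_mul_I_ne_one hu)).scomp u (hasDerivAt_neg u)
  have e := funext (Sl_eq_re (s + 1))
  rw [e, Cl_eq_re]
  have h3 := Complex.reCLM.hasFDerivAt.comp_hasDerivAt u ((h1.sub h2).div_const (2 * Complex.I))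
  push_cast
  convert! h3 using 1
  simp only [Complex.reCLM_apply]
  congr 1
  rw [neg_smul, one_smul]
  field_simp [Complex.I_ne_zero]
  ring

lemma hasDerivAt_Cl {s : ℝ} (hs : 0 < s) {u : ℝ} (hu : Complex.exp (u * Complex.I) ≠ 1) :
    HasDerivAt (Cl (s + 1)) (-Sl s u) u := by
  have h1 := hasDerivAt_expZeta (s := s) (by simpa using hs) hu
  have h2 := (hasDerivAt_expZeta (s := s) (by simpa using hs)
    (exp_neg_mul_I_ne_one hu)).scomp u (hasDerivAt_neg u)
  have e := funext (Cl_eq_re (s + 1))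
  rw [e, Sl_eq_re]
  have h3 := Complex.reCLM.hasFDerivAt.comp_hasDerivAt u ((h1.add h2).div_const 2)
  push_cast
  convert! h3 using 1
  rw [← Complex.neg_re, Complex.reCLM_apply]
  congr 1
  rw [neg_smul, one_smul, ← div_div, Complex.div_I]
  ring

lemma Cl_neg (s u : ℝ) : Cl s (-u) = Cl s u := by
  rw [Cl, Cl, neg_div, AddCircle.coe_neg, HurwitzZeta.cosZeta_neg]

lemma Sl_neg (s u : ℝ) : Sl s (-u) = -Sl s u := by
  rw [Sl, Sl, neg_div, AddCircle.coe_neg, HurwitzZeta.sinZeta_neg, Complex.neg_re]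

lemma coe_add_two_pi_div (u : ℝ) :
    (((u + 2 * π) / (2 * π) : ℝ) : UnitAddCircle) = ((u / (2 * π) : ℝ) : UnitAddCircle) := by
  rw [add_div, div_self Real.two_pi_pos.ne', AddCircle.coe_add_period]

lemma Cl_add_two_pi (s u : ℝ) : Cl s (u + 2 * π) = Cl s u := by
  rw [Cl, Cl, coe_add_two_pi_div]

lemma Sl_add_two_pi (s u : ℝ) : Sl s (u + 2 * π) = Sl s u := by
  rw [Sl, Sl, coe_add_two_pi_div]

lemma Cl_sub_pi (s u : ℝ) : Cl s (u - π) = Cl s (u + π) := by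
  rw [← Cl_add_two_pi s (u - π)]; ring_nf

lemma Sl_sub_pi (s u : ℝ) : Sl s (u - π) = Sl s (u + π) := by
  rw [← Sl_add_two_pi s (u - π)]; ring_nf

lemma Sl_pi (s : ℝ) : Sl s π = 0 := by
  have h := Sl_sub_pi s 0
  rw [zero_sub, zero_add, Sl_neg] at h
  linarith

lemma Cl_zero (s : ℝ) : Cl s 0 = realZeta s := by
  rw [Cl, realZeta, zero_div, AddCircle.coe_zero, HurwitzZeta.cosZeta_zero]

/-- The integral of `|f|` on an interval where `f` is nonnegative and has a primitive. -/
lemma integral_abs_of_hasDerivAt_nonneg {f F : ℝ → ℝ} {a b : ℝ} (hab : a ≤ b)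
    (hF : Continuous F) (hd : ∀ y ∈ Ioo a b, HasDerivAt F (f y) y)
    (hf : ∀ y ∈ Ioo a b, 0 ≤ f y) :
    IntervalIntegrable (fun y => |f y|) MeasureTheory.volume a b ∧
      ∫ y in a..b, |f y| = F b - F a := by
  have hd' : ∀ y ∈ Ioo a b, HasDerivAt F |f y| y := fun y hy => by
    rw [abs_of_nonneg (hf y hy)]
    exact hd y hy
  have hi : IntervalIntegrable (fun y => |f y|) MeasureTheory.volume a b :=
    intervalIntegral.intervalIntegrable_deriv_of_nonneg hF.continuousOn
      (by simpa [hab] using hd') fun y _ => abs_nonneg _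
  exact ⟨hi, intervalIntegral.integral_eq_sub_of_hasDerivAt_of_le hab hF.continuousOn hd' hi⟩

/-- The integral of `|f|` on an interval where `f` is nonpositive and has a primitive. -/
lemma integral_abs_of_hasDerivAt_nonpos {f F : ℝ → ℝ} {a b : ℝ} (hab : a ≤ b)
    (hF : Continuous F) (hd : ∀ y ∈ Ioo a b, HasDerivAt F (f y) y)
    (hf : ∀ y ∈ Ioo a b, f y ≤ 0) :
    IntervalIntegrable (fun y => |f y|) MeasureTheory.volume a b ∧
      ∫ y in a..b, |f y| = F a - F b := by
  have h := integral_abs_of_hasDerivAt_nonneg (f := fun y => -f y) (F := fun y => -F y) hab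
    hF.neg (fun y hy => (hd y hy).neg) fun y hy => neg_nonneg.mpr (hf y hy)
  simp only [abs_neg] at h
  exact ⟨h.1, by rw [h.2]; ring⟩

section Sign

variable {α x : ℝ}

lemma continuousOn_Ihat (hα : α ∈ Ioo (-1 : ℝ) 0) (hx : x ∈ Ioo (0 : ℝ) π) :
    ContinuousOn (Ihat α x) (Ioo 0 1) := by
  intro t ht
  have hC : ∀ {v : ℝ}, 0 < v → v < 2 * π → ContinuousAt (Cl (-α)) v := fun h1 h2 =>
    continuousAt_Cl (by linarith [hα.2])
      (exp_mul_I_ne_one_of_abs_lt h1.ne' (by rwa [abs_of_pos h1]))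
  have p1 := mul_pos hx.1 ht.1
  have p2 := mul_pos hx.1 (sub_pos.mpr ht.2)
  have c1 := ContinuousAt.comp (f := fun t : ℝ => x * (1 - t)) (x := t)
    (hC p2 (by linarith [hx.2])) (by fun_prop)
  have c2 := ContinuousAt.comp (f := fun t : ℝ => x * (1 + t)) (x := t)
    (hC (by linarith) (by linarith [hx.2])) (by fun_prop)
  have c3 := ContinuousAt.comp (f := fun t : ℝ => x * t) (x := t)
    (hC p1 (by linarith [hx.2])) (by fun_prop)
  exact ((c1.add c2).sub (c3.const_mul 2)).continuousWithinAt

lemma tendsto_Ihat_nhdsGT_zero (hα : α ∈ Ioo (-1 : ℝ) 0) (hx : x ∈ Ioo (0 : ℝ) π) :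
    Tendsto (Ihat α x) (𝓝[>] 0) atBot := by
  have hC : ContinuousAt (Cl (-α)) x := continuousAt_Cl (by linarith [hα.2])
    (exp_mul_I_ne_one_of_abs_lt hx.1.ne' (by rw [abs_of_pos hx.1]; linarith [hx.1, hx.2]))
  have c1 : ContinuousAt (fun t : ℝ => Cl (-α) (x * (1 - t))) 0 :=
    ContinuousAt.comp (g := Cl (-α)) (f := fun t : ℝ => x * (1 - t)) (x := 0)
      (by simpa using hC) (by fun_prop)
  have c2 : ContinuousAt (fun t : ℝ => Cl (-α) (x * (1 + t))) 0 :=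
    ContinuousAt.comp (g := Cl (-α)) (f := fun t : ℝ => x * (1 + t)) (x := 0)
      (by simpa using hC) (by fun_prop)
  have c3 : Tendsto (fun t : ℝ => x * t) (𝓝[>] 0) (𝓝[>] 0) := by
    refine tendsto_nhdsWithin_iff.mpr ⟨?_, ?_⟩
    · have : Tendsto (fun t : ℝ => x * t) (𝓝 0) (𝓝 (x * 0)) := (continuous_const_mul x).tendsto 0
      rw [mul_zero] at this
      exact this.mono_left nhdsWithin_le_nhds
    · filter_upwards [self_mem_nhdsWithin] with t ht using mul_pos hx.1 ht
  have h3 := (tendsto_Cl_nhdsGT_zero (s := -α)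
    ⟨by linarith [hα.2], by linarith [hα.1]⟩).comp c3
  have h4 := tendsto_neg_atTop_atBot.comp (h3.const_mul_atTop two_pos)
  exact (((c1.add c2).tendsto.mono_left nhdsWithin_le_nhds).add_atBot h4)

lemma tendsto_Ihat_nhdsLT_one (hα : α ∈ Ioo (-1 : ℝ) 0) (hx : x ∈ Ioo (0 : ℝ) π) :
    Tendsto (Ihat α x) (𝓝[<] 1) atTop := by
  have hC : ∀ {v : ℝ}, 0 < v → v < 2 * π → ContinuousAt (Cl (-α)) v := fun h1 h2 =>
    continuousAt_Cl (by linarith [hα.2])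
      (exp_mul_I_ne_one_of_abs_lt h1.ne' (by rwa [abs_of_pos h1]))
  have c1 : ContinuousAt (fun t : ℝ => Cl (-α) (x * (1 + t))) 1 :=
    ContinuousAt.comp (f := fun t : ℝ => x * (1 + t))
      (hC (by linarith [hx.1]) (by linarith [hx.2])) (by fun_prop)
  have c2 : ContinuousAt (fun t : ℝ => Cl (-α) (x * t)) 1 :=
    ContinuousAt.comp (f := fun t : ℝ => x * t)
      (hC (by linarith [hx.1]) (by linarith [hx.1, hx.2])) (by fun_prop)
  have c3 : Tendsto (fun t : ℝ => x * (1 - t)) (𝓝[<] 1) (𝓝[>] 0) := by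
    refine tendsto_nhdsWithin_iff.mpr ⟨?_, ?_⟩
    · have : Tendsto (fun t : ℝ => x * (1 - t)) (𝓝 1) (𝓝 (x * (1 - 1))) :=
        Continuous.tendsto (by fun_prop) 1
      rw [sub_self, mul_zero] at this
      exact this.mono_left nhdsWithin_le_nhds
    · filter_upwards [self_mem_nhdsWithin] with t ht using mul_pos hx.1 (sub_pos.mpr ht)
  have h3 := (tendsto_Cl_nhdsGT_zero (s := -α)
    ⟨by linarith [hα.2], by linarith [hα.1]⟩).comp c3
  refine (h3.atTop_add ((c1.sub (c2.const_mul 2)).tendsto.mono_left nhdsWithin_le_nhds)).congr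
    fun t => ?_
  simp only [Function.comp_apply, Pi.sub_apply, Ihat]
  ring


/-- Before its only zero, `Î_α(x, ·)` is negative. -/
lemma Ihat_neg_of_lt_root {r : ℝ} (hα : α ∈ Ioo (-1 : ℝ) 0) (hx : x ∈ Ioo (0 : ℝ) π)
    (huniq : ∀ t ∈ Ioo (0 : ℝ) 1, Ihat α x t = 0 → t = r) {t : ℝ} (ht : t ∈ Ioo (0 : ℝ) 1)
    (htr : t < r) : Ihat α x t < 0 := by
  by_contra! h
  obtain ⟨t₀, h₀, hneg⟩ := ((eventually_mem_set.mpr (Ioo_mem_nhdsGT ht.1)).and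
    ((tendsto_Ihat_nhdsGT_zero hα hx).eventually_lt_atBot 0)).exists
  obtain ⟨c, hc, hc0⟩ := intermediate_value_Icc h₀.2.le
    ((continuousOn_Ihat hα hx).mono (Icc_subset_Ioo h₀.1 ht.2)) ⟨hneg.le, h⟩
  have := huniq c ⟨h₀.1.trans_le hc.1, hc.2.trans_lt ht.2⟩ hc0
  linarith [hc.2]

/-- After its only zero, `Î_α(x, ·)` is positive. -/
lemma Ihat_pos_of_root_lt {r : ℝ} (hα : α ∈ Ioo (-1 : ℝ) 0) (hx : x ∈ Ioo (0 : ℝ) π)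
    (huniq : ∀ t ∈ Ioo (0 : ℝ) 1, Ihat α x t = 0 → t = r) {t : ℝ} (ht : t ∈ Ioo (0 : ℝ) 1)
    (hrt : r < t) : 0 < Ihat α x t := by
  by_contra! h
  obtain ⟨t₁, h₁, hpos⟩ := ((eventually_mem_set.mpr (Ioo_mem_nhdsLT ht.2)).and
    ((tendsto_Ihat_nhdsLT_one hα hx).eventually_gt_atTop 0)).exists
  obtain ⟨c, hc, hc0⟩ := intermediate_value_Icc h₁.1.le
    ((continuousOn_Ihat hα hx).mono (Icc_subset_Ioo ht.1 h₁.2)) ⟨h, hpos.le⟩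
  have := huniq c ⟨ht.1.trans_le hc.1, hc.2.trans_lt h₁.2⟩ hc0
  linarith [hc.1]

end Sign

/-- A primitive of `y ↦ (C_s(x - y) + C_s(x + y) - 2 C_s(y)) y`. -/
noncomputable def primitiveU (s x y : ℝ) : ℝ :=
  (Cl (s + 1 + 1) (x - y) + Cl (s + 1 + 1) (x + y) - 2 * Cl (s + 1 + 1) y) +
    (-Sl (s + 1) (x - y) + Sl (s + 1) (x + y) - 2 * Sl (s + 1) y) * y

lemma continuous_primitiveU {s : ℝ} (hs : 0 < s) (x : ℝ) : Continuous (primitiveU s x) := by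
  have hC := continuous_Cl (s := s + 1 + 1) (by linarith)
  have hS := continuous_Sl (s := s + 1) (by linarith)
  unfold primitiveU
  fun_prop

lemma hasDerivAt_primitiveU {s x y : ℝ} (hs : 0 < s)
    (h1 : Complex.exp ((x - y : ℝ) * Complex.I) ≠ 1)
    (h2 : Complex.exp ((x + y : ℝ) * Complex.I) ≠ 1)
    (h3 : Complex.exp (y * Complex.I) ≠ 1) :
    HasDerivAt (primitiveU s x) ((Cl s (x - y) + Cl s (x + y) - 2 * Cl s y) * y) y := by
  have hs1 : 0 < s + 1 := by linarith
  have d1 : HasDerivAt (fun y : ℝ => x - y) (-1) y := (hasDerivAt_id y).const_sub x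
  have d2 : HasDerivAt (fun y : ℝ => x + y) 1 y := (hasDerivAt_id y).const_add x
  have c := (((hasDerivAt_Cl hs1 h1).comp y d1).add ((hasDerivAt_Cl hs1 h2).comp y d2)).sub
    ((hasDerivAt_Cl hs1 h3).const_mul 2)
  have d := ((((hasDerivAt_Sl hs h1).comp y d1).neg.add ((hasDerivAt_Sl hs h2).comp y d2)).sub
    ((hasDerivAt_Sl hs h3).const_mul 2)).mul (hasDerivAt_id y)
  convert! c.add d using 1
  simp
  ring

lemma primitiveU_zero (s x : ℝ) :
    primitiveU s x 0 = 2 * (Cl (s + 1 + 1) x - realZeta (s + 1 + 1)) := by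
  rw [primitiveU, sub_zero, add_zero, Cl_zero]
  ring

lemma primitiveU_pi (s x : ℝ) :
    primitiveU s x π = 2 * (Cl (s + 1 + 1) (x + π) - Cl (s + 1 + 1) π) := by
  rw [primitiveU, Cl_sub_pi, Sl_sub_pi, Sl_pi]
  ring

/-- Explicit primitive formula for `U_α(x) = ∫₀^π |I_α(x,y)|·y dy` with weight `|x|`,
in terms of Clausen functions and the root `r = r_{α,x}`. -/
theorem U_primitive (α x r : ℝ) (hα : α ∈ Set.Ioo (-1 : ℝ) 0)
    (hx : x ∈ Set.Ioo (0 : ℝ) π) (hr : r ∈ Set.Ioo (0 : ℝ) 1)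
    (hroot : Ihat α x r = 0)
    (huniq : ∀ t ∈ Set.Ioo (0 : ℝ) 1, Ihat α x t = 0 → t = r) :
    (∫ y in (0:ℝ)..π, |Cl (-α) (x - y) + Cl (-α) (x + y) - 2 * Cl (-α) y| * y) =
      2 * (Cl (2 - α) x - realZeta (2 - α)) + 2 * (Cl (2 - α) (x + π) - Cl (2 - α) π)
      - 2 * (Cl (2 - α) (x * (1 - r)) + Cl (2 - α) (x * (1 + r)) - 2 * Cl (2 - α) (x * r))
      - 2 * x * r * (-Sl (1 - α) (x * (1 - r)) + Sl (1 - α) (x * (1 + r))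
          - 2 * Sl (1 - α) (x * r)) := by
  have hs : 0 < -α := by linarith [hα.2]
  have hπ := Real.pi_pos
  obtain ⟨hx0, hxπ⟩ := hx
  have hrx0 : 0 < x * r := mul_pos hx0 hr.1
  have hrxx : x * r < x := by nlinarith [hr.2]
  have hF := continuous_primitiveU hs x
  have hd : ∀ y ∈ Ioo 0 π, y ≠ x → HasDerivAt (primitiveU (-α) x)
      ((Cl (-α) (x - y) + Cl (-α) (x + y) - 2 * Cl (-α) y) * y) y := by
    intro y hy hyx
    refine hasDerivAt_primitiveU hs (exp_mul_I_ne_one_of_abs_lt (sub_ne_zero.mpr hyx.symm) ?_)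
      (exp_mul_I_ne_one_of_abs_lt (by linarith [hy.1]) ?_)
      (exp_mul_I_ne_one_of_abs_lt hy.1.ne' ?_) <;>
    rw [abs_lt] <;> constructor <;> linarith [hy.1, hy.2]
  have hI : ∀ y, Ihat α x (y / x) = Cl (-α) (x - y) + Cl (-α) (x + y) - 2 * Cl (-α) y := by
    intro y
    rw [Ihat, mul_sub, mul_add, mul_one, mul_div_cancel₀ y hx0.ne']
  obtain ⟨i1, e1⟩ := integral_abs_of_hasDerivAt_nonpos hrx0.le hF
    (fun y hy => hd y ⟨hy.1, by linarith [hy.2]⟩ (by linarith [hy.2]))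
    (fun y hy => mul_nonpos_of_nonpos_of_nonneg (by
      rw [← hI y]
      refine (Ihat_neg_of_lt_root hα ⟨hx0, hxπ⟩ huniq
        ⟨div_pos hy.1 hx0, (div_lt_one hx0).mpr (hy.2.trans hrxx)⟩ ?_).le
      rw [div_lt_iff₀ hx0]
      linarith [hy.2]) hy.1.le)
  obtain ⟨i2, e2⟩ := integral_abs_of_hasDerivAt_nonneg hrxx.le hF
    (fun y hy => hd y ⟨hrx0.trans hy.1, by linarith [hy.2]⟩ (by linarith [hy.2]))
    (fun y hy => mul_nonneg (by
      rw [← hI y]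
      refine (Ihat_pos_of_root_lt hα ⟨hx0, hxπ⟩ huniq
        ⟨div_pos (hrx0.trans hy.1) hx0, (div_lt_one hx0).mpr hy.2⟩ ?_).le
      rw [lt_div_iff₀ hx0]
      linarith [hy.1]) (hrx0.trans hy.1).le)
  obtain ⟨i3, e3⟩ := integral_abs_of_hasDerivAt_nonneg hxπ.le hF
    (fun y hy => hd y ⟨hx0.trans hy.1, hy.2⟩ hy.1.ne')
    (fun y hy => mul_nonneg (by
      have h := two_mul_Cl_le (s := -α) ⟨hs, by linarith [hα.1]⟩ (u := y - x) (v := x + y)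
        ⟨by linarith [hy.1], by linarith [hy.2]⟩ ⟨by linarith [hy.1], by linarith [hy.2]⟩
      rw [show (y - x + (x + y)) / 2 = y by ring, ← neg_sub x y, Cl_neg] at h
      linarith) (hx0.trans hy.1).le)
  have hcongr : (∫ y in (0:ℝ)..π, |Cl (-α) (x - y) + Cl (-α) (x + y) - 2 * Cl (-α) y| * y) =
      ∫ y in (0:ℝ)..π, |(Cl (-α) (x - y) + Cl (-α) (x + y) - 2 * Cl (-α) y) * y| := by
    refine intervalIntegral.integral_congr fun y hy => ?_
    rw [uIcc_of_le hπ.le] at hy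
    simp only [abs_mul, abs_of_nonneg hy.1]
  rw [hcongr, ← intervalIntegral.integral_add_adjacent_intervals (i1.trans i2) i3,
    ← intervalIntegral.integral_add_adjacent_intervals i1 i2, e1, e2, e3, primitiveU_zero,
    primitiveU_pi, primitiveU, show -α + 1 + 1 = 2 - α by ring, show -α + 1 = 1 - α by ring,
    show x - x * r = x * (1 - r) by ring, show x + x * r = x * (1 + r) by ring]
  ring
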